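/- The number of (ordinary) Veldkamp lines of the binary Segre variety S_(3), i.e., of unordered triples {H', H'', H'''} of pairwise distinct geometric hyperplanes of S_(3) such that H''' is the complement of the symmetric difference H' Δ H'', is exactly 10795. -/

import Mathlib

open scoped symmDiff

/-- A point of the binary Segre variety `S_(N)`. -/
abbrev SegrePoint (N : ℕ) := Fin N → Fin 3

/-- The line of `S_(N)` through `f` in direction `i`. -/
def segreLine {N : ℕ} (i : Fin N) (f : SegrePoint N) : Set (SegrePoint N) :=
  {x | ∀ j, j ≠ i → x j = f j}

/-- A geometric hyperplane of `S_(N)`: a proper subset of the point set such that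
every line either lies fully in it or meets it in exactly one point. -/
def IsGeomHyperplane {N : ℕ} (H : Set (SegrePoint N)) : Prop :=
  H ≠ Set.univ ∧ ∀ (i : Fin N) (f : SegrePoint N),
    segreLine i f ⊆ H ∨ (segreLine i f ∩ H).ncard = 1

/-- Two points of `S_(N)` are collinear iff they differ in exactly one coordinate. -/
def SegreCollinear {N : ℕ} (x y : SegrePoint N) : Prop :=
  hammingDist x y = 1

/-- An ovoid of `S_(N)`: a set of `3^(N-1)` pairwise non-collinear points. -/
def IsOvoid {N : ℕ} (O : Set (SegrePoint N)) : Prop :=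
  O.ncard = 3 ^ (N - 1) ∧ O.Pairwise fun x y => ¬ SegreCollinear x y

/-- The sum of `F` over every line of `S_(N)` vanishes. -/
def LineSumsZero {N : ℕ} (F : SegrePoint N → ZMod 2) : Prop :=
  ∀ (i : Fin N) (x : SegrePoint N), ∑ a, F (Function.update x i a) = 0

/-- The zero set of a function on the points of `S_(N)`. -/
def zeroLocus {N : ℕ} (F : SegrePoint N → ZMod 2) : Set (SegrePoint N) :=
  {x | F x = 0}

theorem segreLine_eq_range {N : ℕ} (i : Fin N) (x : SegrePoint N) :
    segreLine i x = Set.range (Function.update x i) := by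
  ext y
  constructor
  · intro h
    refine ⟨y i, funext fun j => ?_⟩
    rcases eq_or_ne j i with rfl | hj
    · simp
    · simp [hj, h j hj]
  · rintro ⟨a, rfl⟩ j hj
    simp [hj]

theorem sum_fin_three_eq_zero_iff (h : Fin 3 → ZMod 2) :
    ∑ a, h a = 0 ↔ (∀ a, h a = 0) ∨ (Finset.univ.filter fun a => h a = 0).card = 1 := by
  revert h
  decide

theorem ncard_segreLine_inter_zeroLocus {N : ℕ} (F : SegrePoint N → ZMod 2) (i : Fin N)
    (x : SegrePoint N) :
    (segreLine i x ∩ zeroLocus F).ncard =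
      (Finset.univ.filter fun a => F (Function.update x i a) = 0).card := by
  have : segreLine i x ∩ zeroLocus F = Function.update x i ''
      ((Finset.univ.filter fun a => F (Function.update x i a) = 0 : Finset (Fin 3)) :
        Set (Fin 3)) := by
    rw [segreLine_eq_range]
    ext y
    simp only [zeroLocus, Set.mem_inter_iff, Set.mem_range, Set.mem_ofPred_eq, Finset.coe_filter,
      Finset.mem_univ, true_and, Set.mem_image]
    constructor
    · rintro ⟨⟨a, rfl⟩, h⟩
      exact ⟨a, h, rfl⟩
    · rintro ⟨a, h, rfl⟩
      exact ⟨⟨a, rfl⟩, h⟩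
  rw [this, Set.ncard_image_of_injective _ (Function.update_injective x i), Set.ncard_coe_finset]

theorem isGeomHyperplane_zeroLocus_iff {N : ℕ} (F : SegrePoint N → ZMod 2) :
    IsGeomHyperplane (zeroLocus F) ↔ F ≠ 0 ∧ LineSumsZero F := by
  refine and_congr (not_congr ?_) (forall₂_congr fun i x => ?_)
  · simp [zeroLocus, Set.eq_univ_iff_forall, funext_iff]
  · rw [sum_fin_three_eq_zero_iff, ncard_segreLine_inter_zeroLocus, segreLine_eq_range,
      Set.range_subset_iff]
    rfl

theorem zeroLocus_bijective {N : ℕ} :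
    Function.Bijective (zeroLocus : (SegrePoint N → ZMod 2) → Set (SegrePoint N)) := by
  classical
  have key : ∀ a b : ZMod 2, (a = 0 ↔ b = 0) → a = b := by decide
  constructor
  · intro F G h
    funext x
    exact key _ _ (Set.ext_iff.1 h x)
  · intro H
    refine ⟨fun x => if x ∈ H then 0 else 1, ?_⟩
    ext x
    simp [zeroLocus]

theorem zeroLocus_add {N : ℕ} (F G : SegrePoint N → ZMod 2) :
    zeroLocus (F + G) = (zeroLocus F ∆ zeroLocus G)ᶜ := by
  have key : ∀ a b : ZMod 2, a + b = 0 ↔ ¬ (a = 0 ∧ ¬ b = 0 ∨ b = 0 ∧ ¬ a = 0) := by decide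
  ext x
  exact key (F x) (G x)

theorem LineSumsZero.add {N : ℕ} {F G : SegrePoint N → ZMod 2} (hF : LineSumsZero F)
    (hG : LineSumsZero G) : LineSumsZero (F + G) := fun i x => by
  simp [Finset.sum_add_distrib, hF i x, hG i x]

/-- A function with vanishing line sums is determined by its values on the points all of whose
coordinates differ from `2`. -/
theorem LineSumsZero.eq_zero {N : ℕ} {F : SegrePoint N → ZMod 2} (hF : LineSumsZero F)
    (h0 : ∀ y : Fin N → Fin 2, F (fun j => (y j).castSucc) = 0) : F = 0 := by
  funext x
  induction hn : (Finset.univ.filter fun j => x j = 2).card using Nat.strong_induction_on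
    generalizing x with
  | _ n ih =>
    by_cases hx : ∃ i, x i = 2
    · obtain ⟨i, hi⟩ := hx
      have step : ∀ a : Fin 3, a ≠ 2 → F (Function.update x i a) = 0 := by
        intro a ha
        refine ih _ ?_ _ rfl
        rw [← hn]
        refine Finset.card_lt_card (Finset.ssubset_iff_of_subset ?_ |>.2 ⟨i, ?_, ?_⟩)
        · intro j
          rcases eq_or_ne j i with rfl | hj
          · simp [ha]
          · simp [hj]
        · simpa using hi
        · simpa using ha
      have := hF i x
      rw [Fin.sum_univ_three, step 0 (by decide), step 1 (by decide), ← hi,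
        Function.update_eq_self] at this
      simpa using this
    · push Not at hx
      have key : ∀ a : Fin 3, a ≠ 2 → ∃ b : Fin 2, b.castSucc = a := by decide
      choose y hy using fun j => key (x j) (hx j)
      rw [← funext hy]
      exact h0 y

/-- The extension of a function on the points without coordinate `2` to a function on all points
of `S_(N)` with vanishing line sums. -/
def lineSumsZeroExtension {N : ℕ} (g : (Fin N → Fin 2) → ZMod 2) (x : SegrePoint N) : ZMod 2 :=
  ∑ y : Fin N → Fin 2, (∏ j, if x j = 2 ∨ x j = (y j).castSucc then 1 else 0) * g y

theorem lineSumsZero_extension {N : ℕ} (g : (Fin N → Fin 2) → ZMod 2) :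
    LineSumsZero (lineSumsZeroExtension g) := by
  intro i x
  have key : ∀ b : Fin 2,
      ∑ a : Fin 3, (if a = 2 ∨ a = b.castSucc then (1 : ZMod 2) else 0) = 0 := by decide
  simp only [lineSumsZeroExtension]
  rw [Finset.sum_comm]
  refine Finset.sum_eq_zero fun y _ => ?_
  rw [← Finset.sum_mul]
  simp_rw [← Finset.mul_prod_erase Finset.univ _ (Finset.mem_univ i), Function.update_self]
  have hrest : ∀ a : Fin 3, (∏ j ∈ Finset.univ.erase i,
      if Function.update x i a j = 2 ∨ Function.update x i a j = (y j).castSucc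
        then (1 : ZMod 2) else 0) =
      ∏ j ∈ Finset.univ.erase i, if x j = 2 ∨ x j = (y j).castSucc then 1 else 0 := by
    intro a
    refine Finset.prod_congr rfl fun j hj => ?_
    rw [Function.update_of_ne (Finset.ne_of_mem_erase hj)]
  simp_rw [hrest]
  rw [← Finset.sum_mul, key, zero_mul, zero_mul]

theorem lineSumsZeroExtension_castSucc {N : ℕ} (g : (Fin N → Fin 2) → ZMod 2)
    (y : Fin N → Fin 2) : lineSumsZeroExtension g (fun j => (y j).castSucc) = g y := by
  have key : ∀ b c : Fin 2, (b.castSucc = (2 : Fin 3) ∨ b.castSucc = c.castSucc) ↔ b = c := by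
    decide
  simp only [lineSumsZeroExtension, key, Finset.prod_ite_zero, Finset.mem_univ, forall_const]
  simp [← funext_iff]

theorem card_lineSumsZero (N : ℕ) :
    Nat.card {F : SegrePoint N → ZMod 2 // LineSumsZero F} = 2 ^ 2 ^ N := by
  have hb : Function.Bijective fun g : (Fin N → Fin 2) → ZMod 2 =>
      (⟨lineSumsZeroExtension g, lineSumsZero_extension g⟩ :
        {F : SegrePoint N → ZMod 2 // LineSumsZero F}) := by
    constructor
    · intro g g' h
      funext y
      rw [← lineSumsZeroExtension_castSucc g, ← lineSumsZeroExtension_castSucc g',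
        show lineSumsZeroExtension g = lineSumsZeroExtension g' from congrArg Subtype.val h]
    · rintro ⟨F, hF⟩
      let g : (Fin N → Fin 2) → ZMod 2 := fun y => F fun j => (y j).castSucc
      refine ⟨g, Subtype.ext ?_⟩
      have := ((lineSumsZero_extension g).add hF).eq_zero fun y => by
        simp [lineSumsZeroExtension_castSucc, g, CharTwo.add_self_eq_zero]
      funext x
      exact CharTwo.add_eq_zero.1 (congrFun this x)
  rw [← Nat.card_eq_of_bijective _ hb]
  simp

/-- The number of triples `{a, b, a + b}` with `a ≠ b` in `S`, when `S` consists of the nonzero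
vectors of a vector space over the field with two elements. -/
theorem six_mul_ncard_lines {V : Type*} [AddCommGroup V] [Finite V] (S : Set V)
    (h2 : ∀ a : V, a + a = 0) (h0 : 0 ∉ S)
    (hadd : ∀ a ∈ S, ∀ b ∈ S, a ≠ b → a + b ∈ S) :
    6 * {T : Set V | ∃ a ∈ S, ∃ b ∈ S, a ≠ b ∧ T = {a, b, a + b}}.ncard =
      S.ncard * (S.ncard - 1) := by
  classical
  have := Fintype.ofFinite V
  let s : Finset V := S.toFinset
  let line : V × V → Finset V := fun p => {p.1, p.2, p.1 + p.2}
  have hlines : {T : Set V | ∃ a ∈ S, ∃ b ∈ S, a ≠ b ∧ T = {a, b, a + b}} =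
      (fun t : Finset V => (t : Set V)) '' (s.offDiag.image line : Finset (Finset V)) := by
    ext T
    simp only [Set.mem_ofPred_eq, Set.mem_image, Finset.mem_coe, Finset.mem_image, Prod.exists,
      Finset.mem_offDiag, s, Set.mem_toFinset, line]
    constructor
    · rintro ⟨a, ha, b, hb, hab, rfl⟩
      exact ⟨_, ⟨a, b, ⟨ha, hb, hab⟩, rfl⟩, by simp⟩
    · rintro ⟨_, ⟨a, b, ⟨ha, hb, hab⟩, rfl⟩, rfl⟩
      exact ⟨a, ha, b, hb, hab, by simp⟩
  have hself : ∀ a b : V, a + (a + b) = b := fun a b => by rw [← add_assoc, h2, zero_add]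
  have hfiber : ∀ t ∈ s.offDiag.image line, (s.offDiag.filter fun p => line p = t).card = 6 := by
    intro t ht
    obtain ⟨⟨a, b⟩, hab, rfl⟩ := Finset.mem_image.1 ht
    simp only [Finset.mem_offDiag, s, Set.mem_toFinset] at hab
    obtain ⟨ha, hb, hne⟩ := hab
    have hca : a ≠ a + b := fun h => h0 (by rw [left_eq_add] at h; exact h ▸ hb)
    have hcb : b ≠ a + b := fun h => h0 (by rw [right_eq_add] at h; exact h ▸ ha)
    have hcard : (line (a, b)).card = 3 := Finset.card_eq_three.2 ⟨_, _, _, hne, hca, hcb, rfl⟩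
    have : (s.offDiag.filter fun p => line p = line (a, b)) = (line (a, b)).offDiag := by
      have e1 : b + (a + b) = a := by rw [add_comm a, hself]
      have e2 : a + b + a = b := by rw [add_comm, hself]
      have e3 : a + b + b = a := by rw [add_comm, e1]
      have e4 : b + a = a + b := add_comm b a
      ext ⟨c, d⟩
      simp only [Finset.mem_filter, Finset.mem_offDiag, s, Set.mem_toFinset]
      constructor
      · rintro ⟨⟨-, -, hcd⟩, h⟩
        rw [← h]
        simp [line, hcd]
      · rintro ⟨hc, hd, hcd⟩
        have hc' : a + b ∈ S := hadd a ha b hb hne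
        simp only [line, Finset.mem_insert, Finset.mem_singleton] at hc hd
        rcases hc with rfl | rfl | rfl <;> rcases hd with rfl | rfl | rfl <;>
          first
          | exact absurd rfl hcd
          | refine ⟨⟨by assumption, by assumption, hcd⟩, ?_⟩
            ext x
            simp only [line, Finset.mem_insert, Finset.mem_singleton, hself, e1, e2, e3, e4]
            try tauto
    rw [this, Finset.offDiag_card, hcard]
  have hcount := Finset.card_eq_sum_card_fiberwise (s := s.offDiag) (t := s.offDiag.image line)
    (f := line) fun p hp => Finset.mem_coe.2 (Finset.mem_image_of_mem line hp)
  rw [Finset.sum_congr rfl hfiber, Finset.sum_const, smul_eq_mul, Finset.offDiag_card] at hcount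
  rw [hlines, Set.ncard_image_of_injective _ Finset.coe_injective, Set.ncard_coe_finset, mul_comm,
    ← hcount, Set.ncard_eq_toFinset_card', Nat.mul_sub, mul_one]

theorem ncard_lineSumsZero_ne_zero (N : ℕ) :
    {F : SegrePoint N → ZMod 2 | F ≠ 0 ∧ LineSumsZero F}.ncard = 2 ^ 2 ^ N - 1 := by
  have : {F : SegrePoint N → ZMod 2 | F ≠ 0 ∧ LineSumsZero F} =
      {F | LineSumsZero F} \ {0} := by
    ext F
    simp [and_comm]
  rw [this, Set.ncard_sdiff_singleton_of_mem fun i x => by simp]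
  congr 1
  exact card_lineSumsZero N

theorem segre3_veldkamp_line_count :
    {T : Set (Set (SegrePoint 3)) |
      ∃ H' H'' H''' : Set (SegrePoint 3),
        IsGeomHyperplane H' ∧ IsGeomHyperplane H'' ∧ IsGeomHyperplane H''' ∧
        H' ≠ H'' ∧ H' ≠ H''' ∧ H'' ≠ H''' ∧
        H''' = (H' ∆ H'')ᶜ ∧ T = {H', H'', H'''}}.ncard = 10795 := by
  let S : Set (SegrePoint 3 → ZMod 2) := {F | F ≠ 0 ∧ LineSumsZero F}
  have hadd : ∀ F ∈ S, ∀ G ∈ S, F ≠ G → F + G ∈ S := fun F hF G hG hne =>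
    ⟨fun h => hne (CharTwo.add_eq_zero.1 h), hF.2.add hG.2⟩
  have hcount := six_mul_ncard_lines S CharTwo.add_self_eq_zero (fun h => h.1 rfl) hadd
  rw [ncard_lineSumsZero_ne_zero] at hcount
  have himage : {T : Set (Set (SegrePoint 3)) |
      ∃ H' H'' H''' : Set (SegrePoint 3),
        IsGeomHyperplane H' ∧ IsGeomHyperplane H'' ∧ IsGeomHyperplane H''' ∧
        H' ≠ H'' ∧ H' ≠ H''' ∧ H'' ≠ H''' ∧
        H''' = (H' ∆ H'')ᶜ ∧ T = {H', H'', H'''}} =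
      Set.image zeroLocus '' {T | ∃ F ∈ S, ∃ G ∈ S, F ≠ G ∧ T = {F, G, F + G}} := by
    ext T
    constructor
    · rintro ⟨H', H'', _, h', h'', -, hne, -, -, rfl, rfl⟩
      obtain ⟨F, rfl⟩ := zeroLocus_bijective.2 H'
      obtain ⟨G, rfl⟩ := zeroLocus_bijective.2 H''
      refine ⟨_, ⟨F, (isGeomHyperplane_zeroLocus_iff F).1 h', G,
        (isGeomHyperplane_zeroLocus_iff G).1 h'', fun h => hne (congrArg _ h), rfl⟩, ?_⟩
      simp only [Set.image_insert_eq, Set.image_singleton, zeroLocus_add]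
    · rintro ⟨_, ⟨F, hF, G, hG, hne, rfl⟩, rfl⟩
      refine ⟨zeroLocus F, zeroLocus G, zeroLocus (F + G),
        (isGeomHyperplane_zeroLocus_iff F).2 hF, (isGeomHyperplane_zeroLocus_iff G).2 hG,
        (isGeomHyperplane_zeroLocus_iff _).2 (hadd F hF G hG hne),
        zeroLocus_bijective.1.ne hne, zeroLocus_bijective.1.ne fun h => hG.1 (left_eq_add.1 h),
        zeroLocus_bijective.1.ne fun h => hF.1 (right_eq_add.1 h), zeroLocus_add F G, ?_⟩
      simp only [Set.image_insert_eq, Set.image_singleton]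
  rw [himage, Set.ncard_image_of_injective _ (Set.image_injective.2 zeroLocus_bijective.1)]
  exact Nat.eq_of_mul_eq_mul_left (by norm_num : 0 < 6) (hcount.trans (by norm_num))
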